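/- Let n ≥ 1 and let k be the largest integer with 2^k ≤ n. The ring of invariants Λ_{F_2}(a_1,...,a_n)^{Σ_n} is isomorphic as a graded F_2-algebra to Λ(σ_1, σ_2, σ_4, ..., σ_{2^k}) / R, where R is the ideal generated by all products σ_{2^{i_1}} σ_{2^{i_2}} ⋯ σ_{2^{i_s}} with distinct exponents satisfying 2^{i_1} + ... + 2^{i_s} > n. -/

import Mathlib

open MvPolynomial

/-- The ideal of squares of generators; over `F₂` the quotient of the polynomial ring by this
ideal is the exterior algebra `Λ_{F₂}(a_1, …, a_n)`. -/
noncomputable def sqIdeal (n : ℕ) : Ideal (MvPolynomial (Fin n) (ZMod 2)) :=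
  Ideal.span (Set.range fun i : Fin n => (X i : MvPolynomial (Fin n) (ZMod 2)) ^ 2)

/-- The exterior algebra `Λ_{F₂}(a_1, …, a_n)`, modeled (char 2) as `F₂[a]/(aᵢ²)`. -/
noncomputable abbrev ExtF2 (n : ℕ) : Type :=
  MvPolynomial (Fin n) (ZMod 2) ⧸ sqIdeal n

/-- The action of a permutation `g ∈ Σ_n` on `Λ_{F₂}(a_1,…,a_n)` by permuting generators. -/
noncomputable def permAct (n : ℕ) (g : Equiv.Perm (Fin n)) : ExtF2 n →ₐ[ZMod 2] ExtF2 n :=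
  Ideal.Quotient.liftₐ (sqIdeal n)
    ((Ideal.Quotient.mkₐ (ZMod 2) (sqIdeal n)).comp (rename g : _ →ₐ[ZMod 2] _))
    (by
      intro a ha
      refine Submodule.span_induction ?_ ?_ ?_ ?_ ha
      · rintro _ ⟨i, rfl⟩
        rw [AlgHom.comp_apply, map_pow, rename_X, Ideal.Quotient.mkₐ_eq_mk,
          Ideal.Quotient.eq_zero_iff_mem]
        exact Ideal.subset_span ⟨g i, rfl⟩
      · exact map_zero _
      · intro x y _ _ hx hy; rw [map_add, hx, hy, add_zero]
      · intro c x _ hx; rw [smul_eq_mul, map_mul, hx, mul_zero])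

/-- The `F₂`-subalgebra of `Σ_n`-invariants of `Λ_{F₂}(a_1,…,a_n)`. -/
noncomputable def invSubalgebra (n : ℕ) : Subalgebra (ZMod 2) (ExtF2 n) where
  carrier := {x | ∀ g : Equiv.Perm (Fin n), permAct n g x = x}
  add_mem' := fun hx hy => by intro g; rw [map_add, hx g, hy g]
  mul_mem' := fun hx hy => by intro g; rw [map_mul, hx g, hy g]
  algebraMap_mem' := fun r g => (permAct n g).commutes r

/-- The ideal of relations `R`: in the exterior algebra on generators `σ_1, σ_2, …, σ_{2^k}`
(modeled as a polynomial algebra modulo squares of the generators), we further kill every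
product `σ_{2^{i_1}} ⋯ σ_{2^{i_s}}` of generators with distinct exponents such that
`2^{i_1} + ⋯ + 2^{i_s} > n`. -/
noncomputable def targetIdeal (n : ℕ) :
    Ideal (MvPolynomial (Fin (Nat.log 2 n + 1)) (ZMod 2)) :=
  Ideal.span
    ((Set.range fun i : Fin (Nat.log 2 n + 1) =>
        (X i : MvPolynomial (Fin (Nat.log 2 n + 1)) (ZMod 2)) ^ 2) ∪
      {p | ∃ s : Finset (Fin (Nat.log 2 n + 1)),
        (∑ i ∈ s, 2 ^ (i : ℕ)) > n ∧ p = ∏ i ∈ s, X i})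

theorem mem_span_range_prod_of_sq_eq_zero {σ R A : Type*} [CommSemiring R] [CommSemiring A]
    [Algebra R A] (φ : MvPolynomial σ R →ₐ[R] A) (h : ∀ i, φ (X i) ^ 2 = 0)
    (p : MvPolynomial σ R) :
    φ p ∈ Submodule.span R (Set.range fun s : Finset σ => ∏ i ∈ s, φ (X i)) := by
  induction p using MvPolynomial.induction_on' with
  | add p q hp hq => rw [map_add]; exact add_mem hp hq
  | monomial u a =>
    have key : φ (monomial u a) = a • ∏ i ∈ u.support, φ (X i) ^ u i := by
      rw [monomial_eq, map_mul, Finsupp.prod, map_prod, ← MvPolynomial.algebraMap_eq,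
        AlgHom.commutes, Algebra.smul_def]
      simp
    rw [key]
    by_cases hu : ∀ i ∈ u.support, u i = 1
    · rw [Finset.prod_congr rfl fun i hi => by rw [hu i hi, pow_one]]
      exact Submodule.smul_mem _ _ (Submodule.subset_span ⟨u.support, rfl⟩)
    · push Not at hu
      obtain ⟨i, hi, hi1⟩ := hu
      have hi0 : u i ≠ 0 := Finsupp.mem_support_iff.mp hi
      have hz : φ (X i) ^ u i = 0 := pow_eq_zero_of_le (by omega : 2 ≤ u i) (h i)
      rw [Finset.prod_eq_zero hi hz, smul_zero]
      exact zero_mem _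

/-- The squarefree monomial `∏ i ∈ s, aᵢ` of `Λ_{F₂}(a_1, …, a_n)`. -/
noncomputable def extMonomial (n : ℕ) (s : Finset (Fin n)) : ExtF2 n :=
  ∏ i ∈ s, Ideal.Quotient.mk (sqIdeal n) (X i)

/-- The image of the elementary symmetric polynomial `σ_m` in `Λ_{F₂}(a_1, …, a_n)`. -/
noncomputable def extEsymm (n m : ℕ) : ExtF2 n :=
  Ideal.Quotient.mk (sqIdeal n) (esymm (Fin n) (ZMod 2) m)

theorem extEsymm_eq_sum (n m : ℕ) :
    extEsymm n m = ∑ s ∈ Finset.powersetCard m Finset.univ, extMonomial n s := by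
  simp [extEsymm, extMonomial, esymm]

theorem mk_X_sq (n : ℕ) (i : Fin n) : (Ideal.Quotient.mk (sqIdeal n) (X i)) ^ 2 = 0 := by
  rw [← map_pow, Ideal.Quotient.eq_zero_iff_mem]
  exact Ideal.subset_span ⟨i, rfl⟩

theorem extMonomial_mul_of_disjoint {n : ℕ} {s t : Finset (Fin n)} (h : Disjoint s t) :
    extMonomial n s * extMonomial n t = extMonomial n (s ∪ t) :=
  (Finset.prod_union h).symm

theorem extMonomial_mul_of_not_disjoint {n : ℕ} {s t : Finset (Fin n)} (h : ¬Disjoint s t) :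
    extMonomial n s * extMonomial n t = 0 := by
  obtain ⟨i, hs, ht⟩ := Finset.not_disjoint_iff.mp h
  rw [extMonomial, extMonomial, ← Finset.mul_prod_erase s _ hs, ← Finset.mul_prod_erase t _ ht,
    mul_mul_mul_comm, ← sq, mk_X_sq, zero_mul]

theorem prod_X_eq_monomial {σ : Type*} (s : Finset σ) :
    (∏ i ∈ s, X i : MvPolynomial σ (ZMod 2)) = monomial (∑ i ∈ s, Finsupp.single i 1) 1 := by
  rw [monomial_sum_one]; rfl

theorem sum_single_one_apply {σ : Type*} [DecidableEq σ] (s : Finset σ) (i : σ) :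
    (∑ j ∈ s, Finsupp.single j 1 : σ →₀ ℕ) i = if i ∈ s then 1 else 0 := by
  simp [Finsupp.finsetSum_apply, Finsupp.single_apply]

theorem coeff_eq_zero_of_mem_sqIdeal {n : ℕ} {p : MvPolynomial (Fin n) (ZMod 2)}
    (hp : p ∈ sqIdeal n) (t : Finset (Fin n)) :
    coeff (∑ i ∈ t, Finsupp.single i 1) p = 0 := by
  have h : sqIdeal n = Ideal.span ((fun u : Fin n →₀ ℕ => monomial u (1 : ZMod 2)) ''
      Set.range fun i => Finsupp.single i 2) := by
    rw [← Set.range_comp]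
    simp [sqIdeal, X_pow_eq_monomial, Function.comp_def]
  rw [h, mem_ideal_span_monomial_image] at hp
  by_contra hne
  obtain ⟨_, ⟨i, rfl⟩, hi⟩ := hp _ (mem_support_iff.mpr hne)
  have := hi i
  rw [sum_single_one_apply, Finsupp.single_eq_same] at this
  split_ifs at this <;> omega

theorem linearIndependent_extMonomial (n : ℕ) :
    LinearIndependent (ZMod 2) (extMonomial n) := by
  rw [Fintype.linearIndependent_iff]
  intro c hc t
  have hmem : ∑ s, c s • (∏ i ∈ s, X i : MvPolynomial (Fin n) (ZMod 2)) ∈ sqIdeal n := by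
    rw [← Ideal.Quotient.eq_zero_iff_mem, ← hc, ← Ideal.Quotient.mkₐ_eq_mk (ZMod 2), map_sum]
    simp [extMonomial]
  have hcoeff := coeff_eq_zero_of_mem_sqIdeal hmem t
  have hinj (s : Finset (Fin n)) : (∑ i ∈ s, Finsupp.single i 1 : Fin n →₀ ℕ) =
      ∑ i ∈ t, Finsupp.single i 1 ↔ s = t := by
    refine ⟨fun h => ?_, fun h => h ▸ rfl⟩
    ext i
    have := DFunLike.congr_fun h i
    rw [sum_single_one_apply, sum_single_one_apply] at this
    split_ifs at this <;> simp_all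
  simpa [coeff_sum, prod_X_eq_monomial, coeff_monomial, hinj] using hcoeff

theorem exists_eq_sum_extMonomial (n : ℕ) (x : ExtF2 n) :
    ∃ c : Finset (Fin n) → ZMod 2, ∑ s, c s • extMonomial n s = x := by
  obtain ⟨p, rfl⟩ := Ideal.Quotient.mk_surjective x
  rw [← Submodule.mem_span_range_iff_exists_fun]
  exact mem_span_range_prod_of_sq_eq_zero (Ideal.Quotient.mkₐ (ZMod 2) (sqIdeal n))
    (mk_X_sq n) p

theorem permAct_extMonomial (n : ℕ) (g : Equiv.Perm (Fin n)) (s : Finset (Fin n)) :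
    permAct n g (extMonomial n s) = extMonomial n (s.map g.toEmbedding) := by
  have h (i : Fin n) : permAct n g (Ideal.Quotient.mk (sqIdeal n) (X i)) =
      Ideal.Quotient.mk (sqIdeal n) (X (g i)) := by
    rw [← rename_X (R := ZMod 2) g i]; rfl
  simp [extMonomial, map_prod, h]

theorem extEsymm_mem_invSubalgebra (n m : ℕ) : extEsymm n m ∈ invSubalgebra n := by
  intro g
  change Ideal.Quotient.mk (sqIdeal n) (rename g (esymm (Fin n) (ZMod 2) m)) = _
  rw [rename_esymm, extEsymm]

theorem sum_smul_extMonomial_card (n : ℕ) (d : ℕ → ZMod 2) :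
    ∑ s : Finset (Fin n), d s.card • extMonomial n s =
      ∑ m ∈ Finset.range (n + 1), d m • extEsymm n m := by
  rw [← Finset.powerset_univ, Finset.sum_powerset, Finset.card_univ, Fintype.card_fin]
  refine Finset.sum_congr rfl fun m _ => ?_
  rw [extEsymm_eq_sum, Finset.smul_sum]
  exact Finset.sum_congr rfl fun s hs => by rw [(Finset.mem_powersetCard.mp hs).2]

theorem linearIndependent_extEsymm (n : ℕ) :
    LinearIndependent (ZMod 2) fun m : Fin (n + 1) => extEsymm n m := by
  rw [Fintype.linearIndependent_iff]
  intro c hc m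
  let d : ℕ → ZMod 2 := fun j => if h : j < n + 1 then c ⟨j, h⟩ else 0
  have hd (j : Fin (n + 1)) : d j = c j := dif_pos j.isLt
  have hsum := sum_smul_extMonomial_card n d
  rw [Finset.sum_range (fun m => d m • extEsymm n m)] at hsum
  simp_rw [hd] at hsum
  rw [hc] at hsum
  obtain ⟨s, -, hs⟩ := Finset.exists_subset_card_eq
    (s := (Finset.univ : Finset (Fin n))) (n := m) (by simpa using m.is_le)
  rw [← hd, ← hs]
  exact Fintype.linearIndependent_iff.mp (linearIndependent_extMonomial n) _ hsum s

theorem exists_perm_map_eq {α : Type*} [Fintype α] [DecidableEq α] {s t : Finset α}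
    (h : s.card = t.card) : ∃ g : Equiv.Perm α, s.map g.toEmbedding = t := by
  let e := Finset.equivOfCardEq h
  refine ⟨e.extendSubtype, Finset.eq_of_subset_of_card_le ?_ (by simp [h])⟩
  intro y hy
  obtain ⟨x, hx, rfl⟩ := Finset.mem_map.mp hy
  exact e.extendSubtype_mem x hx

theorem exists_eq_sum_extEsymm {n : ℕ} {x : ExtF2 n} (hx : x ∈ invSubalgebra n) :
    ∃ d : ℕ → ZMod 2, x = ∑ m ∈ Finset.range (n + 1), d m • extEsymm n m := by
  obtain ⟨c, rfl⟩ := exists_eq_sum_extMonomial n x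
  have hinv (g : Equiv.Perm (Fin n)) (s : Finset (Fin n)) : c (s.map g.toEmbedding) = c s := by
    have h1 := hx g
    rw [map_sum, ← (Equiv.finsetCongr g).sum_comp (fun s => c s • extMonomial n s),
      ← sub_eq_zero, ← Finset.sum_sub_distrib] at h1
    simp_rw [map_smul, permAct_extMonomial, Equiv.finsetCongr_apply, ← sub_smul] at h1
    have h2 := Fintype.linearIndependent_iff.mp ((linearIndependent_extMonomial n).comp _
      (Equiv.finsetCongr g).injective) _ h1 s
    exact (sub_eq_zero.mp h2).symm
  have hcard (s t : Finset (Fin n)) (h : s.card = t.card) : c s = c t := by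
    obtain ⟨g, rfl⟩ := exists_perm_map_eq h
    exact (hinv g s).symm
  obtain ⟨d, rfl⟩ : ∃ d : ℕ → ZMod 2, c = fun s => d s.card :=
    ⟨Function.extend Finset.card c 0,
      funext fun s => (Function.FactorsThrough.extend_apply (fun s t h => hcard s t h) _ s).symm⟩
  exact ⟨d, sum_smul_extMonomial_card n d⟩

theorem extEsymm_mul (n i j : ℕ) :
    extEsymm n i * extEsymm n j = ((i + j).choose i : ℕ) • extEsymm n (i + j) := by
  have hl : extEsymm n i * extEsymm n j =
      ∑ p ∈ (Finset.powersetCard i Finset.univ ×ˢ Finset.powersetCard j Finset.univ) with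
        Disjoint p.1 p.2, extMonomial n (p.1 ∪ p.2) := by
    rw [extEsymm_eq_sum, extEsymm_eq_sum, Finset.sum_mul_sum, ← Finset.sum_product',
      Finset.sum_filter]
    refine Finset.sum_congr rfl fun p _ => ?_
    split_ifs with h
    · exact extMonomial_mul_of_disjoint h
    · exact extMonomial_mul_of_not_disjoint h
  have hr : ((i + j).choose i : ℕ) • extEsymm n (i + j) =
      ∑ q ∈ (Finset.powersetCard (i + j) Finset.univ).sigma
        fun u : Finset (Fin n) => Finset.powersetCard i u, extMonomial n q.1 := by
    rw [Finset.sum_sigma, extEsymm_eq_sum, Finset.smul_sum]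
    refine Finset.sum_congr rfl fun u hu => ?_
    dsimp only
    rw [Finset.sum_const, Finset.card_powersetCard, (Finset.mem_powersetCard.mp hu).2]
  rw [hl, hr]
  refine Finset.sum_bij' (fun p _ => ⟨p.1 ∪ p.2, p.1⟩) (fun q _ => (q.2, q.1 \ q.2))
    ?_ ?_ ?_ ?_ ?_
  · rintro ⟨s, t⟩ h
    simp only [Finset.mem_filter, Finset.mem_product, Finset.mem_powersetCard,
      Finset.subset_univ, true_and] at h
    simp [Finset.card_union_of_disjoint h.2, h.1.1, h.1.2]
  · rintro ⟨u, s⟩ h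
    simp only [Finset.mem_sigma, Finset.mem_powersetCard, Finset.subset_univ, true_and] at h
    simp [Finset.card_sdiff_of_subset h.2.1, h.1, h.2.2, Finset.disjoint_sdiff]
  · rintro ⟨s, t⟩ h
    simp [Finset.union_sdiff_cancel_left (Finset.mem_filter.mp h).2]
  · rintro ⟨u, s⟩ h
    simp only [Finset.mem_sigma, Finset.mem_powersetCard] at h
    simp [Finset.union_sdiff_of_subset h.2.1]
  · intros; rfl

theorem extEsymm_eq_zero {n m : ℕ} (h : n < m) : extEsymm n m = 0 := by
  rw [extEsymm_eq_sum, Finset.powersetCard_eq_empty.mpr (by simpa using h), Finset.sum_empty]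

theorem extEsymm_zero (n : ℕ) : extEsymm n 0 = 1 := by
  simp [extEsymm]

theorem two_nsmul_extF2 {n : ℕ} (x : ExtF2 n) : 2 • x = 0 := by
  rw [← Nat.cast_smul_eq_nsmul (ZMod 2), show ((2 : ℕ) : ZMod 2) = 0 from rfl, zero_smul]

theorem extEsymm_two_pow_sq (n i : ℕ) : extEsymm n (2 ^ i) ^ 2 = 0 := by
  obtain ⟨c, hc⟩ := Nat.two_dvd_centralBinom_of_one_le (n := 2 ^ i) Nat.one_le_two_pow
  rw [sq, extEsymm_mul, ← two_mul, ← Nat.centralBinom_eq_two_mul_choose, hc, mul_nsmul,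
    smul_comm, two_nsmul_extF2]

theorem choose_add_two_pow_modEq_one (a : ℕ) : ∀ m < 2 ^ a,
    (2 ^ a + m).choose (2 ^ a) ≡ 1 [MOD 2] := by
  induction a with
  | zero =>
    intro m hm
    obtain rfl : m = 0 := by omega
    rfl
  | succ a ih =>
    intro m hm
    refine (Choose.choose_modEq_choose_mod_mul_choose_div_nat (p := 2)).trans ?_
    rw [pow_succ'] at hm ⊢
    rw [Nat.mul_mod_right, Nat.choose_zero_right, one_mul, Nat.mul_add_div two_pos,
      Nat.mul_div_cancel_left _ two_pos]
    exact ih _ (by omega)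

theorem extEsymm_two_pow_mul (n : ℕ) {a m : ℕ} (hm : m < 2 ^ a) :
    extEsymm n (2 ^ a) * extEsymm n m = extEsymm n (2 ^ a + m) := by
  rw [extEsymm_mul, ← Nat.cast_smul_eq_nsmul (ZMod 2),
    (ZMod.natCast_eq_natCast_iff _ _ _).mpr (choose_add_two_pow_modEq_one a m hm), Nat.cast_one,
    one_smul]

theorem prod_extEsymm_two_pow (n : ℕ) {k : ℕ} (s : Finset (Fin k)) :
    ∏ i ∈ s, extEsymm n (2 ^ (i : ℕ)) = extEsymm n (∑ i ∈ s, 2 ^ (i : ℕ)) := by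
  induction s using Finset.induction_on_max with
  | empty => simp [extEsymm_zero]
  | insert a s ha ih =>
    have hs : a ∉ s := fun h => lt_irrefl _ (ha a h)
    rw [Finset.prod_insert hs, Finset.sum_insert hs, ih, extEsymm_two_pow_mul]
    have := Nat.geomSum_lt (m := 2) (n := (a : ℕ)) (s := s.map Fin.valEmbedding) le_rfl
      (by simpa using ha)
    simpa using this

theorem injective_sum_two_pow (k : ℕ) :
    Function.Injective fun s : Finset (Fin k) => ∑ i ∈ s, 2 ^ (i : ℕ) := by
  intro s t h
  apply Finset.map_injective Fin.valEmbedding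
  apply Finset.geomSum_injective le_rfl
  simpa using h

theorem exists_sum_two_pow_eq {k m : ℕ} (hm : m < 2 ^ k) :
    ∃ s : Finset (Fin k), ∑ i ∈ s, 2 ^ (i : ℕ) = m := by
  have hlt (i : ℕ) (hi : i ∈ m.bitIndices.toFinset) : i < k :=
    (Nat.pow_lt_pow_iff_right one_lt_two).mp
      ((Nat.two_pow_le_of_mem_bitIndices (List.mem_toFinset.mp hi)).trans_lt hm)
  refine ⟨m.bitIndices.toFinset.attachFin hlt, ?_⟩
  refine (Finset.sum_map _ Fin.valEmbedding fun i => 2 ^ i).symm.trans ?_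
  rw [Finset.map_valEmbedding_attachFin, Finset.sum_toFinset_bitIndices_two_pow]

/-- The algebra map sending the `i`-th generator to `σ_{2^i}`. -/
noncomputable def twoPowEsymm (n : ℕ) :
    MvPolynomial (Fin (Nat.log 2 n + 1)) (ZMod 2) →ₐ[ZMod 2] invSubalgebra n :=
  aeval fun i => ⟨extEsymm n (2 ^ (i : ℕ)), extEsymm_mem_invSubalgebra n _⟩

theorem coe_twoPowEsymm_prod (n : ℕ) (s : Finset (Fin (Nat.log 2 n + 1))) :
    (twoPowEsymm n (∏ i ∈ s, X i) : ExtF2 n) = extEsymm n (∑ i ∈ s, 2 ^ (i : ℕ)) := by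
  rw [← prod_extEsymm_two_pow, map_prod, ← Subalgebra.coe_val, map_prod]
  simp [twoPowEsymm]

theorem targetIdeal_le_ker (n : ℕ) : targetIdeal n ≤ RingHom.ker (twoPowEsymm n) := by
  refine Ideal.span_le.mpr ?_
  rintro _ (⟨i, rfl⟩ | ⟨s, hs, rfl⟩) <;> refine RingHom.mem_ker.mpr (Subtype.ext ?_)
  · simpa [twoPowEsymm] using extEsymm_two_pow_sq n i
  · rw [coe_twoPowEsymm_prod, extEsymm_eq_zero hs]; rfl

theorem surjective_twoPowEsymm (n : ℕ) : Function.Surjective (twoPowEsymm n) := by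
  rintro ⟨x, hx⟩
  obtain ⟨d, rfl⟩ := exists_eq_sum_extEsymm hx
  suffices h : ∑ m ∈ Finset.range (n + 1), d m • extEsymm n m ∈
      ((invSubalgebra n).val.comp (twoPowEsymm n)).range by
    obtain ⟨p, hp⟩ := h
    exact ⟨p, Subtype.ext hp⟩
  refine sum_mem fun m hm => Subalgebra.smul_mem _ ?_ _
  obtain ⟨s, rfl⟩ := exists_sum_two_pow_eq (k := Nat.log 2 n + 1) (m := m)
    ((Finset.mem_range_succ_iff.mp hm).trans_lt (Nat.lt_pow_succ_log_self one_lt_two n))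
  exact ⟨_, coe_twoPowEsymm_prod n s⟩

theorem mk_mem_span_small_products (n : ℕ) (p : MvPolynomial (Fin (Nat.log 2 n + 1)) (ZMod 2)) :
    Ideal.Quotient.mk (targetIdeal n) p ∈ Submodule.span (ZMod 2) (Set.range
      fun s : {s : Finset (Fin (Nat.log 2 n + 1)) // ∑ i ∈ s, 2 ^ (i : ℕ) ≤ n} =>
        Ideal.Quotient.mk (targetIdeal n) (∏ i ∈ s.1, X i)) := by
  refine Submodule.span_le.mpr ?_ (mem_span_range_prod_of_sq_eq_zero
    (Ideal.Quotient.mkₐ (ZMod 2) (targetIdeal n)) (fun i => ?_) p)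
  · rintro _ ⟨s, rfl⟩
    by_cases hs : ∑ i ∈ s, 2 ^ (i : ℕ) ≤ n
    · exact Submodule.subset_span ⟨⟨s, hs⟩, map_prod _ _ _⟩
    · dsimp only
      rw [← map_prod, Ideal.Quotient.mkₐ_eq_mk, Ideal.Quotient.eq_zero_iff_mem.mpr]
      · exact zero_mem _
      · exact Ideal.subset_span (Or.inr ⟨s, not_le.mp hs, rfl⟩)
  · rw [← map_pow, Ideal.Quotient.mkₐ_eq_mk, Ideal.Quotient.eq_zero_iff_mem]
    exact Ideal.subset_span (Or.inl ⟨i, rfl⟩)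

theorem ker_twoPowEsymm (n : ℕ) : RingHom.ker (twoPowEsymm n) = targetIdeal n := by
  refine le_antisymm (fun p hp => ?_) (targetIdeal_le_ker n)
  obtain ⟨c, hc⟩ := (Submodule.mem_span_range_iff_exists_fun _).mp
    (mk_mem_span_small_products n p)
  let q := ∑ s : {s : Finset (Fin (Nat.log 2 n + 1)) // ∑ i ∈ s, 2 ^ (i : ℕ) ≤ n},
    c s • (∏ i ∈ s.1, X i : MvPolynomial (Fin (Nat.log 2 n + 1)) (ZMod 2))
  have hpq : p - q ∈ targetIdeal n := by
    rw [← Ideal.Quotient.mk_eq_mk_iff_sub_mem, ← hc, ← Ideal.Quotient.mkₐ_eq_mk (ZMod 2)]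
    simp only [q, map_sum, map_smul]
  have hq : twoPowEsymm n q = 0 := by
    have h := RingHom.mem_ker.mp (targetIdeal_le_ker n hpq)
    rwa [map_sub, RingHom.mem_ker.mp hp, zero_sub, neg_eq_zero] at h
  have hsum : ∑ s, c s • extEsymm n (∑ i ∈ s.1, 2 ^ (i : ℕ)) = 0 := by
    have h := congrArg (invSubalgebra n).val hq
    simpa only [q, map_sum, map_smul, map_zero, Subalgebra.coe_val, coe_twoPowEsymm_prod] using h
  have hc0 := Fintype.linearIndependent_iff.mp ((linearIndependent_extEsymm n).comp
    (fun s : {s : Finset (Fin (Nat.log 2 n + 1)) // ∑ i ∈ s, 2 ^ (i : ℕ) ≤ n} =>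
      (⟨∑ i ∈ s.1, 2 ^ (i : ℕ), Nat.lt_succ_of_le s.2⟩ : Fin (n + 1)))
    fun s t h => Subtype.ext (injective_sum_two_pow _ (congrArg Fin.val h))) c hsum
  have : q = 0 := Finset.sum_eq_zero fun s _ => by rw [hc0 s, zero_smul]
  rwa [this, sub_zero] at hpq

/-- for `n ≥ 1`, with `k = ⌊log₂ n⌋`, the ring of invariants
`Λ_{F₂}(a_1,…,a_n)^{Σ_n}` is isomorphic, as a graded `F₂`-algebra, to
`Λ(σ_1, σ_2, σ_4, …, σ_{2^k})/R`; the isomorphism sends the degree-`2^i` generator to the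
elementary symmetric polynomial `σ_{2^i}` (which has degree `2^i`). -/
theorem stmt7 (n : ℕ) (hn : 1 ≤ n) :
    ∃ f : (MvPolynomial (Fin (Nat.log 2 n + 1)) (ZMod 2) ⧸ targetIdeal n) ≃ₐ[ZMod 2]
        invSubalgebra n,
      ∀ i : Fin (Nat.log 2 n + 1),
        ((f (Ideal.Quotient.mk (targetIdeal n) (X i)) : invSubalgebra n) : ExtF2 n) =
          Ideal.Quotient.mk (sqIdeal n) (esymm (Fin n) (ZMod 2) (2 ^ (i : ℕ))) := by
  refine ⟨(Ideal.quotientEquivAlgOfEq (ZMod 2) (ker_twoPowEsymm n).symm).trans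
    (Ideal.quotientKerAlgEquivOfSurjective (surjective_twoPowEsymm n)),
    fun i => ?_⟩
  change ((twoPowEsymm n (X i) : invSubalgebra n) : ExtF2 n) = _
  rw [twoPowEsymm, aeval_X]
  rfl
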